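/- Let N be a nonunital commutative associative ℂ-algebra which is 2-dimensional as a ℂ-vector space and nilpotent, i.e. there exists m ≥ 1 such that every product of m elements of N vanishes. Then either a·b = 0 for all a, b ∈ N, or there exists a ℂ-basis (e₁, e₂) of N satisfying e₁·e₁ = e₂ and e₁·e₂ = e₂·e₁ = e₂·e₂ = 0 (so that N is isomorphic to A₂); these two alternatives are mutually exclusive. -/

import Mathlib

/-- The left-associated product of `m + 1` elements of a (possibly nonunital,
nonassociative) multiplicative structure. -/
def leftProd {N : Type*} [Mul N] : ∀ {m : ℕ}, (Fin (m + 1) → N) → N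
  | 0, f => f 0
  | _ + 1, f => leftProd (fun i => f i.castSucc) * f (Fin.last _)

/-- The product `v * x * ⋯ * x` is the iterated multiplication by `x` applied to `v`. -/
theorem leftProd_ite_eq_mulLeft_pow {R N : Type*} [CommSemiring R] [NonUnitalCommRing N]
    [Module R N] [SMulCommClass R N N] [IsScalarTower R N N] (x v : N) (m : ℕ) :
    leftProd (fun i : Fin (m + 1) => if i = 0 then v else x) =
      (LinearMap.mulLeft R x ^ m) v := by
  induction m with
  | zero => simp [leftProd]
  | succ m ih =>
    have hlast : Fin.last (m + 1) ≠ 0 := Fin.last_pos.ne'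
    simp only [leftProd, Fin.castSucc_eq_zero_iff, ih, if_neg hlast]
    rw [pow_succ', Module.End.mul_apply, LinearMap.mulLeft_apply, mul_comm]

/-- A nilpotent endomorphism of a finite-dimensional space vanishes when raised to the
dimension. -/
theorem IsNilpotent.pow_finrank_eq_zero {K V : Type*} [Field K] [AddCommGroup V] [Module K V]
    [FiniteDimensional K V] {φ : Module.End K V} (h : IsNilpotent φ) :
    φ ^ Module.finrank K V = 0 := by
  have hφ := φ.aeval_self_charpoly
  rwa [h.charpoly_eq_X_pow_finrank, map_pow, Polynomial.aeval_X] at hφ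

/-- If all squares vanish, then so do all products, when `2` is invertible. -/
theorem mul_eq_zero_of_forall_mul_self_eq_zero {K N : Type*} [Field K] [NeZero (2 : K)]
    [NonUnitalCommRing N] [Module K N] (h : ∀ x : N, x * x = 0) (a b : N) : a * b = 0 := by
  have hab := h (a + b)
  rw [add_mul, mul_add, mul_add, h a, h b, mul_comm b a, zero_add, add_zero,
    ← two_smul K] at hab
  exact (smul_eq_zero.1 hab).resolve_left two_ne_zero

/-- A 2-dimensional nilpotent nonunital commutative associative ℂ-algebra either has
identically zero multiplication, or admits a basis `(e₁, e₂)` with `e₁ * e₁ = e₂` and all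
other products zero (so it is isomorphic to `A₂`); these alternatives are mutually
exclusive. -/
theorem two_dim_nilpotent_classification (N : Type*) [NonUnitalCommRing N]
    [Module ℂ N] [IsScalarTower ℂ N N] [SMulCommClass ℂ N N]
    (hdim : Module.finrank ℂ N = 2)
    (hnilp : ∃ m : ℕ, ∀ f : Fin (m + 1) → N, leftProd f = 0) :
    Xor' (∀ a b : N, a * b = 0)
      (∃ e₁ e₂ : N, LinearIndependent ℂ ![e₁, e₂] ∧
        Submodule.span ℂ {e₁, e₂} = ⊤ ∧
        e₁ * e₁ = e₂ ∧ e₁ * e₂ = 0 ∧ e₂ * e₁ = 0 ∧ e₂ * e₂ = 0) := by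
  have : FiniteDimensional ℂ N := Module.finite_of_finrank_eq_succ hdim
  by_cases h : ∀ a b : N, a * b = 0
  · refine Or.inl ⟨h, ?_⟩
    rintro ⟨e₁, e₂, hli, -, hsq, -⟩
    exact hli.ne_zero 1 (hsq.symm.trans (h e₁ e₁))
  · refine Or.inr ⟨?_, h⟩
    obtain ⟨x, hx⟩ : ∃ x : N, x * x ≠ 0 := by
      by_contra! hsq
      exact h (mul_eq_zero_of_forall_mul_self_eq_zero (K := ℂ) hsq)
    obtain ⟨m, hm⟩ := hnilp
    have hL : IsNilpotent (LinearMap.mulLeft ℂ x) :=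
      ⟨m, LinearMap.ext fun v => by rw [← leftProd_ite_eq_mulLeft_pow, hm, LinearMap.zero_apply]⟩
    have hcube : x * (x * x) = 0 := by
      have hpow := hL.pow_finrank_eq_zero
      rw [hdim, pow_two] at hpow
      exact LinearMap.congr_fun hpow x
    have hli : LinearIndependent ℂ ![x, x * x] := by
      rw [LinearIndependent.pair_iff]
      intro s t hst
      have hmul := congrArg (x * ·) hst
      simp only [mul_add, mul_smul_comm, hcube, smul_zero, add_zero, mul_zero] at hmul
      obtain rfl : s = 0 := (smul_eq_zero.1 hmul).resolve_right hx
      rw [zero_smul, zero_add] at hst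
      exact ⟨rfl, (smul_eq_zero.1 hst).resolve_right hx⟩
    refine ⟨x, x * x, hli, ?_, rfl, hcube, by rw [mul_comm, hcube], ?_⟩
    · have hspan := hli.span_eq_top_of_card_eq_finrank (by simp [hdim])
      rwa [Matrix.range_cons_cons_empty] at hspan
    · rw [mul_assoc, hcube, mul_zero]
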